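/- All terms in the star combinatory calculus for arithmetic are reducible, where reducibility is defined by recursion on types: a term of ground type N is reducible iff it is strongly normalizable; a term t of type σ→τ is reducible iff tq is reducible for every reducible q of type σ; a term t of type σ* is reducible iff t is strongly normalizable and for every term obtained by reduction of t, its surface elements are reducible. -/

import Mathlib

namespace StarArith

/-- Finite types over the ground type `N`, closed under `→` and `*`. -/
inductive Ty : Type where
  | ground : Ty          -- the type `N` of natural numbers
  | arrow : Ty → Ty → Ty
  | star : Ty → Ty
deriving DecidableEq, Repr

/-- Terms of the star combinatory calculus for arithmetic. -/
inductive ATerm : Ty → Type where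
  | var (n : ℕ) (σ : Ty) : ATerm σ
  | zero : ATerm .ground
  | succ : ATerm (Ty.ground.arrow .ground)
  | recr (σ : Ty) :
      ATerm (Ty.ground.arrow (σ.arrow ((σ.arrow (Ty.ground.arrow σ)).arrow σ)))
  | pi (σ τ : Ty) : ATerm (σ.arrow (τ.arrow σ))
  | sigma (ρ σ τ : Ty) :
      ATerm ((ρ.arrow (σ.arrow τ)).arrow ((ρ.arrow σ).arrow (ρ.arrow τ)))
  | sing (σ : Ty) : ATerm (σ.arrow σ.star)
  | union (σ : Ty) : ATerm (σ.star.arrow (σ.star.arrow σ.star))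
  | bigUnion (σ τ : Ty) : ATerm (σ.star.arrow ((σ.arrow τ.star).arrow τ.star))
  | app {σ τ : Ty} (t : ATerm (σ.arrow τ)) (q : ATerm σ) : ATerm τ

/-- One-step reduction: apply one of the conversions
`Σtqr ⇝ tr(qr)`, `Πtq ⇝ t`, `⋃(𝔰t)q ⇝ qt`, `⋃(∪tq)r ⇝ ∪(⋃tr)(⋃qr)`,
`R0qr ⇝ q`, `R(St)qr ⇝ r(Rtqr)t` to a subterm. -/
inductive Step : {σ : Ty} → ATerm σ → ATerm σ → Prop where
  | sigma {ρ σ τ : Ty} (t : ATerm (ρ.arrow (σ.arrow τ))) (q : ATerm (ρ.arrow σ))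
      (r : ATerm ρ) :
      Step ((((ATerm.sigma ρ σ τ).app t).app q).app r) ((t.app r).app (q.app r))
  | pi {σ τ : Ty} (t : ATerm σ) (q : ATerm τ) :
      Step (((ATerm.pi σ τ).app t).app q) t
  | bigUnion_sing {σ τ : Ty} (t : ATerm σ) (q : ATerm (σ.arrow τ.star)) :
      Step (((ATerm.bigUnion σ τ).app ((ATerm.sing σ).app t)).app q) (q.app t)
  | bigUnion_union {σ τ : Ty} (t q : ATerm σ.star) (r : ATerm (σ.arrow τ.star)) :
      Step (((ATerm.bigUnion σ τ).app (((ATerm.union σ).app t).app q)).app r)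
        (((ATerm.union τ).app (((ATerm.bigUnion σ τ).app t).app r)).app
          (((ATerm.bigUnion σ τ).app q).app r))
  | rec_zero {σ : Ty} (q : ATerm σ) (r : ATerm (σ.arrow (Ty.ground.arrow σ))) :
      Step ((((ATerm.recr σ).app .zero).app q).app r) q
  | rec_succ {σ : Ty} (t : ATerm .ground) (q : ATerm σ)
      (r : ATerm (σ.arrow (Ty.ground.arrow σ))) :
      Step ((((ATerm.recr σ).app (ATerm.succ.app t)).app q).app r)
        ((r.app ((((ATerm.recr σ).app t).app q).app r)).app t)
  | app_left {σ τ : Ty} {t t' : ATerm (σ.arrow τ)} (q : ATerm σ) :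
      Step t t' → Step (t.app q) (t'.app q)
  | app_right {σ τ : Ty} (t : ATerm (σ.arrow τ)) {q q' : ATerm σ} :
      Step q q' → Step (t.app q) (t.app q')

/-- `t ⪰ q` : `t` reduces to `q` by finitely many (possibly zero) one-step reductions. -/
def Reduces {σ : Ty} (t q : ATerm σ) : Prop :=
  Relation.ReflTransGen Step t q

/-- A term is normal if no one-step reduction applies to it. -/
def Normal {σ : Ty} (t : ATerm σ) : Prop :=
  ∀ q : ATerm σ, ¬ Step t q

/-- A term is strongly normalizable if there is no infinite chain of one-step
reductions starting from it. -/
def SN {σ : Ty} (t : ATerm σ) : Prop :=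
  ¬ ∃ f : ℕ → ATerm σ, f 0 = t ∧ ∀ n : ℕ, Step (f n) (f (n + 1))

/-- A term is closed if it contains no variables. -/
def ATerm.ClosedT : {σ : Ty} → ATerm σ → Prop
  | _, .var _ _ => False
  | _, .app t q => t.ClosedT ∧ q.ClosedT
  | _, _ => True

/-- A term of star type is set-like if it is constructed solely from terms of the
form `𝔰q` and the constant `∪`. -/
inductive SetLike : {σ : Ty} → ATerm σ.star → Prop where
  | sing {σ : Ty} (q : ATerm σ) : SetLike ((ATerm.sing σ).app q)
  | union {σ : Ty} {t₁ t₂ : ATerm σ.star} :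
      SetLike t₁ → SetLike t₂ → SetLike (((ATerm.union σ).app t₁).app t₂)

/-- `SMem s t` : `s` is a surface element of the star-type term `t`, i.e. `s ∈ SM(t)`
where `SM(𝔰q) = {q}`, `SM(∪qr) = SM(q) ∪ SM(r)` and `SM(t) = ∅` otherwise. -/
inductive SMem : {σ : Ty} → ATerm σ → ATerm σ.star → Prop where
  | sing {σ : Ty} (q : ATerm σ) : SMem q ((ATerm.sing σ).app q)
  | unionL {σ : Ty} {s : ATerm σ} {a b : ATerm σ.star} :
      SMem s a → SMem s (((ATerm.union σ).app a).app b)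
  | unionR {σ : Ty} {s : ATerm σ} {a b : ATerm σ.star} :
      SMem s b → SMem s (((ATerm.union σ).app a).app b)

/-- Tait-style reducibility, defined by recursion on the type: at ground type `N`,
reducible = strongly normalizable; at `σ → τ`, `t` is reducible iff `tq` is
reducible for every reducible `q`; at `σ*`, `t` is reducible iff `t` is strongly
normalizable and all surface elements of all terms obtained by reduction of `t` are
reducible. -/
def Red : {σ : Ty} → ATerm σ → Prop
  | .ground, t => SN t
  | .arrow σ _, t => ∀ q : ATerm σ, Red q → Red (t.app q)
  | .star σ, t => SN t ∧ ∀ q : ATerm σ.star, Reduces t q → ∀ s : ATerm σ, SMem s q → Red s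

/-- The numeral `S(S(⋯(S0)))` for the natural number `n`. -/
def numeral : ℕ → ATerm .ground
  | 0 => .zero
  | n + 1 => ATerm.succ.app (numeral n)

end StarArith

/-- Accessibility is preserved when adding a well-founded relation `s` through which `r`-steps
lift. -/
theorem acc_or_of_lift {α : Type*} {r s : α → α → Prop} (hs : WellFounded s)
    (h : ∀ a b c, s b a → r c b → ∃ d, r d a ∧ s c d) {a : α} (ha : Acc r a) :
    Acc (fun x y => r x y ∨ s x y) a := by
  have lift : ∀ a b, Relation.ReflTransGen s b a → ∀ c, r c b →
      ∃ d, r d a ∧ Relation.ReflTransGen s c d := by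
    intro a b hba
    induction hba with
    | refl => exact fun c hc => ⟨c, hc, .refl⟩
    | tail _ hs' ih =>
      intro c hc
      obtain ⟨d, hd, hcd⟩ := ih c hc
      obtain ⟨e, he, hde⟩ := h _ _ _ hs' hd
      exact ⟨e, he, hcd.tail hde⟩
  suffices H : ∀ b, Relation.ReflTransGen s b a → Acc (fun x y => r x y ∨ s x y) b from
    H a .refl
  induction ha with
  | intro a _ ih =>
    intro b
    induction b using hs.induction with
    | _ b ihb =>
      intro hba
      refine ⟨_, fun c hc => ?_⟩
      rcases hc with hc | hc
      · obtain ⟨d, hd, hcd⟩ := lift a b hba c hc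
        exact ih d hd c hcd
      · exact ihb c hc (.head hc hba)

namespace StarArith

theorem sn_iff_acc {σ : Ty} (t : ATerm σ) : SN t ↔ Acc (fun a b => Step b a) t := by
  rw [acc_iff_isEmpty_descending_chain, SN, ← not_nonempty_iff]
  refine not_congr ⟨fun ⟨f, h⟩ => ⟨f, h⟩, fun ⟨f, h⟩ => ⟨f, h⟩⟩

theorem sn_of_step {σ : Ty} {t : ATerm σ} (h : ∀ u, Step t u → SN u) : SN t :=
  (sn_iff_acc t).2 ⟨_, fun u hu => (sn_iff_acc u).1 (h u hu)⟩

theorem SN.step {σ : Ty} {t u : ATerm σ} (h : SN t) (hu : Step t u) : SN u :=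
  (sn_iff_acc u).2 (((sn_iff_acc t).1 h).inv hu)

/-- A map that sends steps to steps reflects strong normalizability. -/
theorem SN.of_map {σ τ : Ty} (f : ATerm σ → ATerm τ)
    (hf : ∀ a b, Step a b → Step (f a) (f b)) {t : ATerm σ} (h : SN (f t)) : SN t :=
  fun ⟨g, h0, hg⟩ => h ⟨fun n => f (g n), congrArg f h0, fun n => hf _ _ (hg n)⟩

/-- Terms whose head is a variable or a constant applied to all the arguments of its redex. -/
inductive Neutral : {σ : Ty} → ATerm σ → Prop where
  | var (n : ℕ) (σ : Ty) : Neutral (.var n σ)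
  | pi {σ τ : Ty} (t : ATerm σ) (q : ATerm τ) : Neutral (((ATerm.pi σ τ).app t).app q)
  | sigma {ρ σ τ : Ty} (t : ATerm (ρ.arrow (σ.arrow τ))) (q : ATerm (ρ.arrow σ)) (r : ATerm ρ) :
      Neutral ((((ATerm.sigma ρ σ τ).app t).app q).app r)
  | bigUnion {σ τ : Ty} (t : ATerm σ.star) (q : ATerm (σ.arrow τ.star)) :
      Neutral (((ATerm.bigUnion σ τ).app t).app q)
  | recr {σ : Ty} (t : ATerm .ground) (q : ATerm σ) (r : ATerm (σ.arrow (Ty.ground.arrow σ))) :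
      Neutral ((((ATerm.recr σ).app t).app q).app r)
  | app {σ τ : Ty} {t : ATerm (σ.arrow τ)} (q : ATerm σ) : Neutral t → Neutral (t.app q)

theorem Neutral.step_app {σ τ : Ty} {t : ATerm (σ.arrow τ)} {q : ATerm σ} {u : ATerm τ}
    (ht : Neutral t) (h : Step (t.app q) u) :
    (∃ t', Step t t' ∧ u = t'.app q) ∨ ∃ q', Step q q' ∧ u = t.app q' := by
  cases h with
  | app_left _ h => exact .inl ⟨_, h, rfl⟩
  | app_right _ h => exact .inr ⟨_, h, rfl⟩
  | sigma => cases ht with | app _ h => cases h with | app _ h => cases h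
  | pi => cases ht with | app _ h => cases h
  | bigUnion_sing => cases ht with | app _ h => cases h
  | bigUnion_union => cases ht with | app _ h => cases h
  | rec_zero => cases ht with | app _ h => cases h with | app _ h => cases h
  | rec_succ => cases ht with | app _ h => cases h with | app _ h => cases h

theorem Neutral.not_smem {σ : Ty} {t : ATerm σ.star} (ht : Neutral t) (s : ATerm σ) :
    ¬ SMem s t := by
  intro h
  cases h with
  | sing => cases ht with | app _ h => cases h
  | unionL => cases ht with | app _ h => cases h with | app _ h => cases h
  | unionR => cases ht with | app _ h => cases h with | app _ h => cases h

theorem red_ground {t : ATerm .ground} : Red t ↔ SN t := by rw [Red]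

theorem red_arrow {σ τ : Ty} {t : ATerm (σ.arrow τ)} :
    Red t ↔ ∀ q : ATerm σ, Red q → Red (t.app q) := by rw [Red]

theorem red_star {σ : Ty} {t : ATerm σ.star} :
    Red t ↔ SN t ∧ ∀ q : ATerm σ.star, Reduces t q → ∀ s : ATerm σ, SMem s q → Red s := by
  rw [Red]

/-- Tait's three closure properties of reducibility. -/
theorem red_candidate (σ : Ty) :
    (∀ t : ATerm σ, Red t → SN t) ∧ (∀ t u : ATerm σ, Red t → Step t u → Red u) ∧
      ∀ t : ATerm σ, Neutral t → (∀ u, Step t u → Red u) → Red t := by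
  induction σ with
  | ground =>
    simp only [red_ground]
    exact ⟨fun _ h => h, fun _ _ h hu => h.step hu, fun _ _ h => sn_of_step h⟩
  | star σ _ =>
    refine ⟨fun t h => (red_star.1 h).1, fun t u h hu => ?_, fun t ht h => ?_⟩
    · rw [red_star] at h ⊢
      exact ⟨h.1.step hu, fun q hq => h.2 q (.head hu hq)⟩
    · rw [red_star]
      refine ⟨sn_of_step fun u hu => (red_star.1 (h u hu)).1, fun q hq s hs => ?_⟩
      rcases Relation.ReflTransGen.cases_head hq with rfl | ⟨u, hu, huq⟩
      · exact absurd hs (ht.not_smem s)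
      · exact (red_star.1 (h u hu)).2 q huq s hs
  | arrow σ τ ihσ ihτ =>
    obtain ⟨snσ, stepσ, neuσ⟩ := ihσ
    obtain ⟨snτ, stepτ, neuτ⟩ := ihτ
    refine ⟨fun t h => ?_, fun t u h hu => ?_, fun t ht h => ?_⟩
    · have hv : Red (ATerm.var 0 σ) := neuσ _ (.var 0 σ) fun u hu => by cases hu
      exact SN.of_map (fun a => a.app (.var 0 σ)) (fun _ _ => Step.app_left _)
        (snτ _ (red_arrow.1 h _ hv))
    · rw [red_arrow] at h ⊢
      exact fun q hq => stepτ _ _ (h q hq) (.app_left q hu)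
    · rw [red_arrow]
      intro q hq
      have := snσ q hq
      rw [sn_iff_acc] at this
      induction this with
      | intro q _ ih =>
        refine neuτ _ (.app q ht) fun u hu => ?_
        rcases ht.step_app hu with ⟨t', ht', rfl⟩ | ⟨q', hq', rfl⟩
        · exact red_arrow.1 (h t' ht') q hq
        · exact ih q' hq' (stepσ _ _ hq hq')

variable {ρ σ τ : Ty}

theorem Red.sn {t : ATerm σ} (h : Red t) : SN t := (red_candidate σ).1 t h

theorem Red.step {t u : ATerm σ} (h : Red t) (hu : Step t u) : Red u :=
  (red_candidate σ).2.1 t u h hu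

theorem Red.app {t : ATerm (σ.arrow τ)} {q : ATerm σ} (ht : Red t) (hq : Red q) :
    Red (t.app q) := red_arrow.1 ht q hq

theorem Neutral.red {t : ATerm σ} (ht : Neutral t) (h : ∀ u, Step t u → Red u) : Red t :=
  (red_candidate σ).2.2 t ht h

theorem red_var (n : ℕ) (σ : Ty) : Red (ATerm.var n σ) :=
  (Neutral.var n σ).red fun u hu => by cases hu

theorem red_zero : Red ATerm.zero :=
  red_ground.2 (sn_of_step fun u hu => by cases hu)

theorem red_succ : Red ATerm.succ := by
  refine red_arrow.2 fun t ht => red_ground.2 ?_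
  have acc := (sn_iff_acc _).1 ht.sn
  induction acc with
  | intro t _ ih =>
    refine sn_of_step fun u hu => ?_
    cases hu with
    | app_left _ h => cases h
    | app_right _ h => exact ih _ h (ht.step h)

theorem red_pi (σ τ : Ty) : Red (ATerm.pi σ τ) := by
  refine red_arrow.2 fun t ht => red_arrow.2 fun q hq => ?_
  have acc := (sn_iff_acc _).1 ht.sn
  induction acc generalizing q with
  | intro t _ iht =>
    have acc := (sn_iff_acc _).1 hq.sn
    induction acc with
    | intro q _ ihq =>
      refine (Neutral.pi t q).red fun u hu => ?_
      cases hu with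
      | pi => exact ht
      | app_right _ h => exact ihq _ h (hq.step h)
      | app_left _ h =>
        cases h with
        | app_left _ h => cases h
        | app_right _ h => exact iht _ h (ht.step h) q hq

theorem red_sigma (ρ σ τ : Ty) : Red (ATerm.sigma ρ σ τ) := by
  refine red_arrow.2 fun t ht => red_arrow.2 fun q hq => red_arrow.2 fun r hr => ?_
  have acc := (sn_iff_acc _).1 ht.sn
  induction acc generalizing q r with
  | intro t _ iht =>
    have acc := (sn_iff_acc _).1 hq.sn
    induction acc generalizing r with
    | intro q _ ihq =>
      have acc := (sn_iff_acc _).1 hr.sn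
      induction acc with
      | intro r _ ihr =>
        refine (Neutral.sigma t q r).red fun u hu => ?_
        cases hu with
        | sigma => exact (ht.app hr).app (hq.app hr)
        | app_right _ h => exact ihr _ h (hr.step h)
        | app_left _ h =>
          cases h with
          | app_right _ h => exact ihq _ h (hq.step h) r hr
          | app_left _ h =>
            cases h with
            | app_left _ h => cases h
            | app_right _ h => exact iht _ h (ht.step h) q hq r hr

/-- A star-type term is reducible once its own surface elements and its one-step reducts are. -/
theorem red_star_of_step {t : ATerm σ.star} (hs : ∀ s, SMem s t → Red s)
    (h : ∀ u, Step t u → Red u) : Red t := by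
  refine red_star.2 ⟨sn_of_step fun u hu => (h u hu).sn, fun q hq s hsq => ?_⟩
  rcases Relation.ReflTransGen.cases_head hq with rfl | ⟨u, hu, huq⟩
  · exact hs s hsq
  · exact (red_star.1 (h u hu)).2 q huq s hsq

theorem Red.smem {t : ATerm σ.star} {s : ATerm σ} (ht : Red t) (hs : SMem s t) : Red s :=
  (red_star.1 ht).2 t .refl s hs

theorem red_sing (σ : Ty) : Red (ATerm.sing σ) := by
  refine red_arrow.2 fun t ht => ?_
  have acc := (sn_iff_acc _).1 ht.sn
  induction acc with
  | intro t _ ih =>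
    refine red_star_of_step (fun s hs => ?_) fun u hu => ?_
    · cases hs with
      | sing => exact ht
    · cases hu with
      | app_left _ h => cases h
      | app_right _ h => exact ih _ h (ht.step h)

theorem red_union (σ : Ty) : Red (ATerm.union σ) := by
  refine red_arrow.2 fun t ht => red_arrow.2 fun q hq => ?_
  have acc := (sn_iff_acc _).1 ht.sn
  induction acc generalizing q with
  | intro t _ iht =>
    have acc := (sn_iff_acc _).1 hq.sn
    induction acc with
    | intro q _ ihq =>
      refine red_star_of_step (fun s hs => ?_) fun u hu => ?_
      · cases hs with
        | unionL h => exact ht.smem h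
        | unionR h => exact hq.smem h
      · cases hu with
        | app_right _ h => exact ihq _ h (hq.step h)
        | app_left _ h =>
          cases h with
          | app_left _ h => cases h
          | app_right _ h => exact iht _ h (ht.step h) q hq

/-- `Operand b a` : `a` is a union one of whose two operands is `b`. -/
inductive Operand : ATerm σ.star → ATerm σ.star → Prop where
  | left (a b : ATerm σ.star) : Operand a (((ATerm.union σ).app a).app b)
  | right (a b : ATerm σ.star) : Operand b (((ATerm.union σ).app a).app b)

theorem wellFounded_operand : WellFounded (Operand (σ := σ)) := by
  refine Subrelation.wf (r := fun a b => sizeOf a < sizeOf b) (fun h => ?_) (measure sizeOf).wf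
  cases h with
  | left => simp; omega
  | right => simp

theorem Operand.lift_step {a b c : ATerm σ.star} (hba : Operand b a) (hbc : Step b c) :
    ∃ d, Step a d ∧ Operand c d := by
  cases hba with
  | left _ e => exact ⟨_, .app_left _ (.app_right _ hbc), .left c e⟩
  | right e _ => exact ⟨_, .app_right _ hbc, .right e c⟩

theorem Operand.red {a b : ATerm σ.star} (hba : Operand b a) (ha : Red a) : Red b := by
  have hb : SN b := by
    cases hba with
    | left _ e =>
      exact SN.of_map (fun x => ((ATerm.union σ).app x).app e)
        (fun _ _ h => .app_left _ (.app_right _ h)) ha.sn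
    | right e _ =>
      exact SN.of_map (fun x => ((ATerm.union σ).app e).app x)
        (fun _ _ h => .app_right _ h) ha.sn
  rw [sn_iff_acc] at hb
  induction hb generalizing a with
  | intro b _ ih =>
    refine red_star_of_step (fun s hs => ?_) fun u hu => ?_
    · cases hba with
      | left => exact ha.smem (.unionL hs)
      | right => exact ha.smem (.unionR hs)
    · obtain ⟨d, hd, hud⟩ := hba.lift_step hu
      exact ih u hu hud (ha.step hd)

theorem red_bigUnion (σ τ : Ty) : Red (ATerm.bigUnion σ τ) := by
  refine red_arrow.2 fun t ht => red_arrow.2 fun q hq => ?_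
  have acc := acc_or_of_lift (r := fun a b => Step b a) wellFounded_operand
    (fun _ _ _ h h' => h.lift_step h') ((sn_iff_acc t).1 ht.sn)
  induction acc generalizing q with
  | intro t _ iht =>
    have acc := (sn_iff_acc _).1 hq.sn
    induction acc with
    | intro q _ ihq =>
      refine (Neutral.bigUnion t q).red fun u hu => ?_
      cases hu with
      | bigUnion_sing t => exact hq.app (ht.smem (.sing t))
      | bigUnion_union a b =>
        exact ((red_union τ).app (iht a (.inr (.left a b)) ((Operand.left a b).red ht) q hq)).app
          (iht b (.inr (.right a b)) ((Operand.right a b).red ht) q hq)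
      | app_right _ h => exact ihq _ h (hq.step h)
      | app_left _ h =>
        cases h with
        | app_left _ h => cases h
        | app_right _ h => exact iht _ (.inl h) (ht.step h) q hq

/-- `IsPred n m` : `m` is the successor term `Sn`. -/
def IsPred (n m : ATerm .ground) : Prop := m = ATerm.succ.app n

theorem wellFounded_isPred : WellFounded IsPred := by
  refine Subrelation.wf (r := fun a b => sizeOf a < sizeOf b) (fun h => ?_) (measure sizeOf).wf
  rw [h]
  simp

theorem IsPred.lift_step {a b c : ATerm .ground} (hba : IsPred b a) (hbc : Step b c) :
    ∃ d, Step a d ∧ IsPred c d := by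
  cases hba
  exact ⟨_, .app_right _ hbc, rfl⟩

theorem red_recr (σ : Ty) : Red (ATerm.recr σ) := by
  refine red_arrow.2 fun t ht => red_arrow.2 fun q hq => red_arrow.2 fun r hr => ?_
  have acc := acc_or_of_lift (r := fun a b => Step b a) wellFounded_isPred
    (fun _ _ _ h h' => h.lift_step h') ((sn_iff_acc t).1 ht.sn)
  induction acc generalizing q r with
  | intro t _ iht =>
    have acc := (sn_iff_acc _).1 hq.sn
    induction acc generalizing r with
    | intro q _ ihq =>
      have acc := (sn_iff_acc _).1 hr.sn
      induction acc with
      | intro r _ ihr =>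
        refine (Neutral.recr t q r).red fun u hu => ?_
        cases hu with
        | rec_zero => exact hq
        | rec_succ t =>
          have ht' : Red t :=
            red_ground.2 (SN.of_map (ATerm.succ.app ·) (fun _ _ h => .app_right _ h) ht.sn)
          exact (hr.app (iht t (.inr rfl) ht' q hq r hr)).app ht'
        | app_right _ h => exact ihr _ h (hr.step h)
        | app_left _ h =>
          cases h with
          | app_right _ h => exact ihq _ h (hq.step h) r hr
          | app_left _ h =>
            cases h with
            | app_left _ h => cases h
            | app_right _ h => exact iht _ (.inl h) (ht.step h) q hq r hr

end StarArith

open StarArith in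
/-- All terms in the star combinatory calculus for arithmetic are
reducible (Tait reducibility, defined by recursion on types). -/
theorem all_terms_reducible {σ : Ty} (t : ATerm σ) : Red t := by
  induction t with
  | var n σ => exact red_var n σ
  | zero => exact red_zero
  | succ => exact red_succ
  | recr σ => exact red_recr σ
  | pi σ τ => exact red_pi σ τ
  | sigma ρ σ τ => exact red_sigma ρ σ τ
  | sing σ => exact red_sing σ
  | union σ => exact red_union σ
  | bigUnion σ τ => exact red_bigUnion σ τ
  | app t q ht hq => exact ht.app hq
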